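/- The following symmetry and boundary properties hold: (1) for every k ∈ ℝ, λ₀(k + π) = −λ₁(k) and λ₂(π/2 + k) = −λ₂(π/2 − k); (2) consequently, for all k with cos k ∉ {−1,1} and l ∈ {0,1}, |x_{0,l}(k + π)| = |x_{1,l}(k)| and x_{2,l}(π/2 + k) = x_{2,l}(π/2 − k); (3) lim_{k→0+} x_{0,l}(k) = −(−1)^l/√10, lim_{k→0−} x_{0,l}(k) = (−1)^l/√10, lim_{k→π∓} x_{1,l}(k) = ∓(−1)^l/√10, and x_{2,l}(±π/2) = ±(−1)^l · 2/7. -/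

import Mathlib

noncomputable section

/-- The constant `A = 9√3/(7√7)`. -/
def Aconst : ℝ := 9 * Real.sqrt 3 / (7 * Real.sqrt 7)

/-- `ξ_j(k) = (1/3)·arccos(A·cos k) + 2jπ/3`. -/
def xi (j : ℕ) (k : ℝ) : ℝ :=
  (1 / 3) * Real.arccos (Aconst * Real.cos k) + 2 * j * Real.pi / 3

/-- `λ_j(k) = (2√7/(3√3))·cos(ξ_j(k))`, the three roots of `9λ³ − 7λ − 2cos k = 0`. -/
def lam (j : ℕ) (k : ℝ) : ℝ :=
  (2 * Real.sqrt 7 / (3 * Real.sqrt 3)) * Real.cos (xi j k)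

/-- `x_{j,l}(k) = (−1)^l · λ_j'(k)/√(1 − λ_j(k)²)`. -/
def xfun (j l : ℕ) (k : ℝ) : ℝ :=
  (-1) ^ l * deriv (lam j) k / Real.sqrt (1 - lam j k ^ 2)

open Filter Real

/-! ### The constants -/

theorem Aconst_mul_amplitude :
    2 * Real.sqrt 7 / (3 * Real.sqrt 3) * Aconst = 6 / 7 := by
  have h3 : Real.sqrt 3 ≠ 0 := by positivity
  have h7 : Real.sqrt 7 ≠ 0 := by positivity
  unfold Aconst
  field_simp
  norm_num

theorem amplitude_sq : (2 * Real.sqrt 7 / (3 * Real.sqrt 3)) ^ 2 = 28 / 27 := by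
  rw [div_pow, mul_pow, mul_pow, Real.sq_sqrt (by norm_num), Real.sq_sqrt (by norm_num)]
  norm_num

theorem abs_Aconst_mul_cos_lt_one (k : ℝ) : |Aconst * Real.cos k| < 1 := by
  have hA : Aconst ^ 2 = 243 / 343 := by
    unfold Aconst
    rw [div_pow, mul_pow, mul_pow, Real.sq_sqrt (by norm_num), Real.sq_sqrt (by norm_num)]
    norm_num
  rw [← sq_lt_one_iff_abs_lt_one, mul_pow, hA]
  nlinarith [Real.cos_sq_le_one k]

/-! ### The functions `lam j` as roots of the cubic -/

theorem lam_cubic (j : ℕ) (k : ℝ) :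
    9 * lam j k ^ 3 - 7 * lam j k = 2 * Real.cos k := by
  obtain ⟨h₁, h₂⟩ := abs_lt.1 (abs_Aconst_mul_cos_lt_one k)
  have h : 4 * Real.cos (xi j k) ^ 3 - 3 * Real.cos (xi j k) = Aconst * Real.cos k := by
    rw [← Real.cos_three_mul, ← Real.cos_arccos h₁.le h₂.le,
      ← Real.cos_add_nat_mul_two_pi (Real.arccos _) j]
    congr 1
    unfold xi
    ring
  have hA := Aconst_mul_amplitude
  have hc := amplitude_sq
  unfold lam
  set c := 2 * Real.sqrt 7 / (3 * Real.sqrt 3)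
  linear_combination 9 * c * Real.cos (xi j k) ^ 3 * hc + 7 / 3 * c * h + 7 / 3 * Real.cos k * hA

theorem differentiable_lam (j : ℕ) : Differentiable ℝ (lam j) := by
  intro k
  obtain ⟨h₁, h₂⟩ := abs_lt.1 (abs_Aconst_mul_cos_lt_one k)
  have h : DifferentiableAt ℝ (fun k => Real.arccos (Aconst * Real.cos k)) k :=
    (Real.differentiableAt_arccos.2 ⟨h₁.ne', h₂.ne⟩).comp k
      (f := fun k => Aconst * Real.cos k) (by fun_prop)
  unfold lam xi
  fun_prop

theorem deriv_lam_mul (j : ℕ) (k : ℝ) :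
    (27 * lam j k ^ 2 - 7) * deriv (lam j) k = -2 * Real.sin k := by
  have h := (differentiable_lam j k).hasDerivAt
  have h₁ := ((h.pow 3).const_mul 9).sub (h.const_mul 7)
  have h₂ := (Real.hasDerivAt_cos k).const_mul 2
  have h₃ := (h₁.congr_of_eventuallyEq
    (Eventually.of_forall fun x => (lam_cubic j x).symm)).unique h₂
  norm_num at h₃
  linear_combination h₃

theorem sin_sq_eq_lam (j : ℕ) (k : ℝ) :
    Real.sin k ^ 2 =
      (1 - lam j k ^ 2) * ((81 * (lam j k ^ 2) ^ 2 - 45 * lam j k ^ 2 + 4) / 4) := by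
  linear_combination (1 / 4) * (9 * lam j k ^ 3 - 7 * lam j k + 2 * Real.cos k) * lam_cubic j k
    + Real.sin_sq_add_cos_sq k

/-! ### Symmetries of `lam j` -/

theorem arccos_Aconst_mul_neg (x : ℝ) :
    Real.arccos (Aconst * -x) = Real.pi - Real.arccos (Aconst * x) := by
  rw [mul_neg, Real.arccos_neg]

theorem lam_zero_add_pi (k : ℝ) : lam 0 (k + Real.pi) = -lam 1 k := by
  unfold lam xi
  rw [Real.cos_add_pi, arccos_Aconst_mul_neg, ← mul_neg, ← Real.cos_pi_sub]
  congr 2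
  push_cast
  ring

theorem lam_two_pi_sub (k : ℝ) : lam 2 (Real.pi - k) = -lam 2 k := by
  unfold lam xi
  rw [Real.cos_pi_sub, arccos_Aconst_mul_neg, ← mul_neg, ← Real.cos_pi_sub,
    ← Real.cos_add_two_pi (Real.pi - _)]
  congr 2
  push_cast
  ring

theorem lam_neg (j : ℕ) (k : ℝ) : lam j (-k) = lam j k := by
  simp only [lam, xi, Real.cos_neg]

theorem lam_add_two_pi (j : ℕ) (k : ℝ) : lam j (k + 2 * Real.pi) = lam j k := by
  simp only [lam, xi, Real.cos_add_two_pi]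

theorem lam_zero_zero : lam 0 0 = 1 := by
  have hpos : 0 < lam 0 0 := by
    refine mul_pos (by positivity) (Real.cos_pos_of_mem_Ioo ⟨?_, ?_⟩) <;>
    · unfold xi
      push_cast
      linarith [Real.arccos_nonneg (Aconst * Real.cos 0), Real.arccos_le_pi (Aconst * Real.cos 0),
        Real.pi_pos]
  have h := lam_cubic 0 0
  rw [Real.cos_zero] at h
  have h' : (lam 0 0 - 1) * ((3 * lam 0 0 + 1) * (3 * lam 0 0 + 2)) = 0 := by
    linear_combination h
  rcases mul_eq_zero.1 h' with h' | h'
  · linarith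
  · exact absurd h' (by positivity)

theorem lam_two_pi_div_two : lam 2 (Real.pi / 2) = 0 := by
  have h := lam_two_pi_sub (Real.pi / 2)
  rw [sub_half] at h
  linarith

/-! ### Symmetries of `xfun j l` -/

theorem xfun_neg (j l : ℕ) (k : ℝ) : xfun j l (-k) = -xfun j l k := by
  have h : deriv (lam j) (-k) = -deriv (lam j) k := by
    have := deriv_comp_neg (lam j) k
    rw [funext (lam_neg j)] at this
    linarith
  unfold xfun
  rw [h, lam_neg]
  ring

theorem xfun_add_two_pi (j l : ℕ) (k : ℝ) : xfun j l (k + 2 * Real.pi) = xfun j l k := by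
  unfold xfun
  rw [← deriv_comp_add_const, funext (lam_add_two_pi j), lam_add_two_pi]

theorem xfun_zero_add_pi (l : ℕ) (k : ℝ) : xfun 0 l (k + Real.pi) = -xfun 1 l k := by
  unfold xfun
  rw [← deriv_comp_add_const, funext lam_zero_add_pi, lam_zero_add_pi, deriv.fun_neg,
    neg_sq, mul_neg, neg_div]

theorem xfun_one_eq (l : ℕ) (k : ℝ) : xfun 1 l k = -xfun 0 l (k - Real.pi) := by
  rw [← xfun_add_two_pi 0, show k - Real.pi + 2 * Real.pi = k + Real.pi by ring, xfun_zero_add_pi,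
    neg_neg]

theorem xfun_two_pi_sub (l : ℕ) (k : ℝ) : xfun 2 l (Real.pi - k) = xfun 2 l k := by
  have h : deriv (lam 2) (Real.pi - k) = deriv (lam 2) k := by
    have := deriv_comp_const_sub (f := lam 2) Real.pi k
    rw [funext lam_two_pi_sub, deriv.fun_neg] at this
    linarith
  unfold xfun
  rw [h, lam_two_pi_sub, neg_sq]

/-! ### Boundary values -/

theorem xfun_two_pi_div_two (l : ℕ) : xfun 2 l (Real.pi / 2) = (-1 : ℝ) ^ l * (2 / 7) := by
  have h := deriv_lam_mul 2 (Real.pi / 2)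
  rw [lam_two_pi_div_two, Real.sin_pi_div_two] at h
  have h' : deriv (lam 2) (Real.pi / 2) = 2 / 7 := by linarith
  unfold xfun
  rw [lam_two_pi_div_two, h']
  simp

theorem tendsto_xfun_zero_right (l : ℕ) :
    Tendsto (xfun 0 l) (nhdsWithin 0 (Set.Ioi 0)) (nhds (-(-1 : ℝ) ^ l / Real.sqrt 10)) := by
  have hc : Continuous (lam 0) := (differentiable_lam 0).continuous
  have hQ : ContinuousAt (fun k => (81 * (lam 0 k ^ 2) ^ 2 - 45 * lam 0 k ^ 2 + 4) / 4) 0 := by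
    fun_prop
  have hD : ContinuousAt (fun k => 27 * lam 0 k ^ 2 - 7) 0 := by fun_prop
  have hD0 : 27 * lam 0 0 ^ 2 - 7 = 20 := by rw [lam_zero_zero]; norm_num
  have hQ0 : (81 * (lam 0 0 ^ 2) ^ 2 - 45 * lam 0 0 ^ 2 + 4) / 4 = 10 := by
    rw [lam_zero_zero]; norm_num
  have hlim : ContinuousAt (fun k => (-1 : ℝ) ^ l *
      (-2 * Real.sqrt ((81 * (lam 0 k ^ 2) ^ 2 - 45 * lam 0 k ^ 2 + 4) / 4)) /
        (27 * lam 0 k ^ 2 - 7)) 0 :=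
    (continuousAt_const.mul (continuousAt_const.mul hQ.sqrt)).div hD (by rw [hD0]; norm_num)
  have hval : (-1 : ℝ) ^ l * (-2 * Real.sqrt 10) / 20 = -(-1 : ℝ) ^ l / Real.sqrt 10 := by
    rw [div_eq_div_iff (by norm_num) (by positivity)]
    linear_combination (-2) * (-1 : ℝ) ^ l * Real.mul_self_sqrt (show (0 : ℝ) ≤ 10 by norm_num)
  have hlim' := hlim.tendsto
  rw [hD0, hQ0, hval] at hlim'
  refine (hlim'.mono_left nhdsWithin_le_nhds).congr' ?_
  have hQpos := hQ.eventually_const_lt ((by norm_num : (0 : ℝ) < 10).trans_eq hQ0.symm)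
  have hDpos := hD.eventually_const_lt ((by norm_num : (0 : ℝ) < 20).trans_eq hD0.symm)
  filter_upwards [nhdsWithin_le_nhds hQpos, nhdsWithin_le_nhds hDpos,
    Ioo_mem_nhdsGT Real.pi_pos] with k hQk hDk hk
  have hsin : 0 < Real.sin k := Real.sin_pos_of_mem_Ioo hk
  have hsq := sin_sq_eq_lam 0 k
  have hu : 0 < 1 - lam 0 k ^ 2 := pos_of_mul_pos_left (hsq ▸ pow_pos hsin 2) hQk.le
  have hs : Real.sin k = Real.sqrt (1 - lam 0 k ^ 2) *
      Real.sqrt ((81 * (lam 0 k ^ 2) ^ 2 - 45 * lam 0 k ^ 2 + 4) / 4) := by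
    rw [← Real.sqrt_mul hu.le, ← hsq, Real.sqrt_sq hsin.le]
  have hd := deriv_lam_mul 0 k
  unfold xfun
  rw [div_eq_div_iff hDk.ne' (Real.sqrt_pos.2 hu).ne']
  rw [hs] at hd
  linear_combination (-(-1 : ℝ) ^ l) * hd

theorem tendsto_xfun_zero_left (l : ℕ) :
    Tendsto (xfun 0 l) (nhdsWithin 0 (Set.Iio 0)) (nhds ((-1 : ℝ) ^ l / Real.sqrt 10)) := by
  have hneg : Tendsto (fun k : ℝ => -k) (nhdsWithin 0 (Set.Iio 0)) (nhdsWithin 0 (Set.Ioi 0)) := by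
    simpa using tendsto_neg_nhdsLT (a := (0 : ℝ))
  have h := ((tendsto_xfun_zero_right l).comp hneg).neg
  rw [neg_div, neg_neg] at h
  refine h.congr fun k => ?_
  rw [Function.comp_apply, xfun_neg, neg_neg]

theorem tendsto_xfun_one_left (l : ℕ) :
    Tendsto (xfun 1 l) (nhdsWithin Real.pi (Set.Iio Real.pi))
      (nhds (-(-1 : ℝ) ^ l / Real.sqrt 10)) := by
  have hsub : Tendsto (fun k : ℝ => k - Real.pi) (nhdsWithin Real.pi (Set.Iio Real.pi))
      (nhdsWithin 0 (Set.Iio 0)) :=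
    tendsto_nhdsWithin_iff.2 ⟨((continuous_sub_right Real.pi).tendsto' _ _ (sub_self _)).mono_left
      nhdsWithin_le_nhds, eventually_mem_nhdsWithin.mono fun k hk => Set.mem_Iio.2 (sub_neg.2 hk)⟩
  rw [neg_div]
  exact ((tendsto_xfun_zero_left l).comp hsub).neg.congr fun k => (xfun_one_eq l k).symm

theorem tendsto_xfun_one_right (l : ℕ) :
    Tendsto (xfun 1 l) (nhdsWithin Real.pi (Set.Ioi Real.pi))
      (nhds ((-1 : ℝ) ^ l / Real.sqrt 10)) := by
  have hsub : Tendsto (fun k : ℝ => k - Real.pi) (nhdsWithin Real.pi (Set.Ioi Real.pi))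
      (nhdsWithin 0 (Set.Ioi 0)) :=
    tendsto_nhdsWithin_iff.2 ⟨((continuous_sub_right Real.pi).tendsto' _ _ (sub_self _)).mono_left
      nhdsWithin_le_nhds, eventually_mem_nhdsWithin.mono fun k hk => Set.mem_Ioi.2 (sub_pos.2 hk)⟩
  have h := ((tendsto_xfun_zero_right l).comp hsub).neg
  rw [neg_div, neg_neg] at h
  exact h.congr fun k => (xfun_one_eq l k).symm

/-- Symmetry and boundary properties of the group velocity
functions `x_{j,l}`: (1) `λ₀(k+π) = −λ₁(k)` and `λ₂(π/2+k) = −λ₂(π/2−k)`;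
(2) `|x_{0,l}(k+π)| = |x_{1,l}(k)|` and `x_{2,l}(π/2+k) = x_{2,l}(π/2−k)`;
(3) the one-sided limits of `x_{0,l}` at `0`, of `x_{1,l}` at `π`, and the
values `x_{2,l}(±π/2) = ±(−1)^l·2/7`. -/
theorem xfun_symmetries_and_boundary_values :
    (∀ k : ℝ, lam 0 (k + Real.pi) = -lam 1 k ∧
      lam 2 (Real.pi / 2 + k) = -lam 2 (Real.pi / 2 - k)) ∧
    (∀ k : ℝ, Real.cos k ≠ 1 → Real.cos k ≠ -1 → ∀ l < 2,
      |xfun 0 l (k + Real.pi)| = |xfun 1 l k| ∧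
      xfun 2 l (Real.pi / 2 + k) = xfun 2 l (Real.pi / 2 - k)) ∧
    (∀ l < 2,
      Filter.Tendsto (xfun 0 l) (nhdsWithin 0 (Set.Ioi 0))
        (nhds (-(-1 : ℝ) ^ l / Real.sqrt 10)) ∧
      Filter.Tendsto (xfun 0 l) (nhdsWithin 0 (Set.Iio 0))
        (nhds ((-1 : ℝ) ^ l / Real.sqrt 10)) ∧
      Filter.Tendsto (xfun 1 l) (nhdsWithin Real.pi (Set.Iio Real.pi))
        (nhds (-(-1 : ℝ) ^ l / Real.sqrt 10)) ∧
      Filter.Tendsto (xfun 1 l) (nhdsWithin Real.pi (Set.Ioi Real.pi))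
        (nhds ((-1 : ℝ) ^ l / Real.sqrt 10)) ∧
      xfun 2 l (Real.pi / 2) = (-1 : ℝ) ^ l * (2 / 7) ∧
      xfun 2 l (-(Real.pi / 2)) = -((-1 : ℝ) ^ l * (2 / 7))) := by
  refine ⟨fun k => ⟨lam_zero_add_pi k, ?_⟩, fun k _ _ l _ => ⟨?_, ?_⟩, fun l _ =>
    ⟨tendsto_xfun_zero_right l, tendsto_xfun_zero_left l, tendsto_xfun_one_left l,
      tendsto_xfun_one_right l, xfun_two_pi_div_two l, ?_⟩⟩
  · rw [← lam_two_pi_sub]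
    congr 1
    ring
  · rw [xfun_zero_add_pi, abs_neg]
  · rw [← xfun_two_pi_sub]
    congr 1
    ring
  · rw [xfun_neg, xfun_two_pi_div_two]
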